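/- There exists a universal constant A > 0 such that for every probability measure μ on ℝ with infinite support and all moments finite, every x* ∈ ℝ, every α > 0, every bounded measurable function f : ℝ → ℝ, every ε > 0, every N > 0 and every n ∈ ℕ, the OPE of size n associated with μ satisfies P( (1/N)|X_{f,α,x*}^{(n)} − E[X_{f,α,x*}^{(n)}]| ≥ ε ) ≤ 2·exp( − ε · min( ε N²/(8A n ‖f‖_∞²), N/(6‖f‖_∞) ) ). -/

import Mathlib

open MeasureTheory ProbabilityTheory Filter Topology

noncomputable section

/-- The squared Vandermonde determinant `∏_{i>j} (λ_i - λ_j)^2`. -/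
def vandSq {n : ℕ} (l : Fin n → ℝ) : ℝ :=
  ∏ q ∈ Finset.univ.filter (fun q : Fin n × Fin n => q.2 < q.1), (l q.1 - l q.2) ^ 2

/-- The orthogonal polynomial ensemble of size `n` associated with `μ`: the probability
measure on `ℝ^n` proportional to `∏_{i>j}(λ_i-λ_j)^2 dμ(λ_1)⋯dμ(λ_n)`. -/
def OPE (μ : Measure ℝ) (n : ℕ) : Measure (Fin n → ℝ) :=
  ((((Measure.pi fun _ : Fin n => μ).withDensity fun l => ENNReal.ofReal (vandSq l))
    Set.univ)⁻¹) •
    ((Measure.pi fun _ : Fin n => μ).withDensity fun l => ENNReal.ofReal (vandSq l))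

/-- The linear statistic `X_f = ∑ f(λ_j)`. -/
def linStat {n : ℕ} (f : ℝ → ℝ) (l : Fin n → ℝ) : ℝ := ∑ j, f (l j)

/-- The scaled linear statistic `X_{f,α,x*} = ∑ f(n^α (λ_j - x*))`. -/
def scaledLinStat {n : ℕ} (f : ℝ → ℝ) (α xs : ℝ) (l : Fin n → ℝ) : ℝ :=
  ∑ j, f ((n : ℝ) ^ α * (l j - xs))

/-- `p` is the family of orthonormal polynomials of `μ`: `p j` has degree `j`, positive
leading coefficient, and `∫ p_i p_j dμ = δ_{ij}`. -/
def IsOrthonormalPolys (μ : Measure ℝ) (p : ℕ → Polynomial ℝ) : Prop :=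
  (∀ j, (p j).degree = (j : WithBot ℕ)) ∧ (∀ j, 0 < (p j).leadingCoeff) ∧
    ∀ i j, ∫ x, (p i).eval x * (p j).eval x ∂μ = if i = j then 1 else 0

/-- All moments of `μ` are finite. -/
def HasAllMoments (μ : Measure ℝ) : Prop := ∀ k : ℕ, Integrable (fun x : ℝ => x ^ k) μ

/-- `μ` has infinite support: no finite set carries full `μ`-measure. -/
def InfiniteSupport (μ : Measure ℝ) : Prop := ∀ s : Finset ℝ, μ ((↑s : Set ℝ)ᶜ) ≠ 0

/-- The Christoffel–Darboux kernel `K_n(x,y) = ∑_{j<n} p_j(x) p_j(y)`. -/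
def CDKernel (p : ℕ → Polynomial ℝ) (n : ℕ) (x y : ℝ) : ℝ :=
  ∑ j ∈ Finset.range n, (p j).eval x * (p j).eval y

/-- The sup norm `‖f‖_∞` of a (bounded) function. -/
def supNorm (f : ℝ → ℝ) : ℝ := ⨆ x, |f x|

/-- The (topological) support of a measure on `ℝ`. -/
def measSupport (μ : Measure ℝ) : Set ℝ := {x | ∀ U ∈ 𝓝 x, μ U ≠ 0}

/-- The sine kernel `sin(πt)/(πt)` (equal to `1` at `t = 0`). -/
def sineKernel (t : ℝ) : ℝ := if t = 0 then 1 else Real.sin (Real.pi * t) / (Real.pi * t)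

/-- `K̃_n(x,y) = w(x)^{1/2} w(y)^{1/2} K_n(x,y)`, where `w` is the Radon–Nikodym
derivative of `μ` with respect to Lebesgue measure. -/
def tildeK (μ : Measure ℝ) (Kf : ℝ → ℝ → ℝ) (x y : ℝ) : ℝ :=
  Real.sqrt ((μ.rnDeriv volume x).toReal) * Real.sqrt ((μ.rnDeriv volume y).toReal) * Kf x y

/-- The Nevai condition at `x*` for a sequence of measures with kernels `Kf n`. -/
def NevaiCond (μ : ℕ → Measure ℝ) (Kf : ℕ → ℝ → ℝ → ℝ) (xs : ℝ) : Prop :=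
  ∀ f : ℝ → ℝ, Continuous f → HasCompactSupport f →
    Tendsto (fun n => ∫ y, (f y - f xs) * Kf n xs y ^ 2 / Kf n xs xs ∂(μ n)) atTop (𝓝 0)

/-- The `α`-Nevai condition at `x*` for a sequence of measures with kernels `Kf n`. -/
def AlphaNevaiCond (μ : ℕ → Measure ℝ) (Kf : ℕ → ℝ → ℝ → ℝ) (α xs : ℝ) : Prop :=
  ∀ f : ℝ → ℝ, Continuous f → HasCompactSupport f →
    ∀ S : Set ℝ, IsCompact S →
      TendstoUniformlyOn
        (fun n s => ∫ y, (f s - f ((n : ℝ) ^ α * (y - xs))) *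
            Kf n (xs + s / (n : ℝ) ^ α) y ^ 2 /
            Kf n (xs + s / (n : ℝ) ^ α) (xs + s / (n : ℝ) ^ α) ∂(μ n))
        (fun _ => 0) atTop S

open scoped MatrixOrder in
lemma exists_det_ne_zero_eq_conjTranspose_mul_self {n : ℕ} {G : Matrix (Fin n) (Fin n) ℝ}
    (hG : G.PosDef) : ∃ B : Matrix (Fin n) (Fin n) ℝ, B.det ≠ 0 ∧ G = B.conjTranspose * B := by
  obtain ⟨B, hB⟩ := CStarAlgebra.nonneg_iff_eq_star_mul_self.mp hG.posSemidef.nonneg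
  rw [Matrix.star_eq_conjTranspose] at hB
  refine ⟨B, fun h => hG.det_pos.ne' ?_, hB⟩
  rw [hB, Matrix.det_mul, h, mul_zero]

/-- The arithmetic-geometric mean inequality for the eigenvalues of a positive semidefinite
matrix. -/
lemma Matrix.PosSemidef.det_le_trace_div_pow {n : ℕ} (hn : n ≠ 0)
    {C : Matrix (Fin n) (Fin n) ℝ} (hC : C.PosSemidef) : C.det ≤ (C.trace / n) ^ n := by
  have hn' : (n : ℝ) ≠ 0 := by exact_mod_cast hn
  have h0 := hC.eigenvalues_nonneg
  rw [hC.isHermitian.det_eq_prod_eigenvalues, hC.isHermitian.trace_eq_sum_eigenvalues]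
  simp only [RCLike.ofReal_real_eq_id, id_eq]
  have h := Real.geom_mean_le_arith_mean_weighted Finset.univ (fun _ => (n : ℝ)⁻¹)
    hC.isHermitian.eigenvalues (fun _ _ => by positivity) (by simp [hn']) (fun i _ => h0 i)
  rw [← Finset.mul_sum, inv_mul_eq_div] at h
  refine le_trans (le_of_eq ?_) (pow_le_pow_left₀
    (Finset.prod_nonneg fun i _ => Real.rpow_nonneg (h0 i) _) h n)
  rw [← Finset.prod_pow]
  exact Finset.prod_congr rfl fun i _ => (Real.rpow_inv_natCast_pow (h0 i) hn).symm

lemma Matrix.PosDef.det_le_det_mul_trace_pow {n : ℕ} (hn : n ≠ 0)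
    {G H : Matrix (Fin n) (Fin n) ℝ} (hG : G.PosDef) (hH : H.PosSemidef) :
    H.det ≤ G.det * ((G⁻¹ * H).trace / n) ^ n := by
  obtain ⟨B, hB, rfl⟩ := exists_det_ne_zero_eq_conjTranspose_mul_self hG
  have h := (hH.conjTranspose_mul_mul_same B⁻¹).det_le_trace_div_pow hn
  rw [Matrix.det_mul, Matrix.det_mul, Matrix.trace_mul_comm, ← Matrix.mul_assoc] at h
  rw [Matrix.mul_inv_rev, ← Matrix.conjTranspose_nonsing_inv]
  have hd : 0 < (B.conjTranspose * B).det := hG.det_pos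
  refine le_trans (le_of_eq ?_) (mul_le_mul_of_nonneg_left h hd.le)
  rw [Matrix.det_mul, Matrix.det_conjTranspose, Matrix.det_conjTranspose, Matrix.det_nonsing_inv]
  simp only [star_trivial, Ring.inverse_eq_inv']
  field_simp

/-- The moment (Hankel) matrix of the weight `w` with respect to `μ`. -/
def momentMatrix (μ : Measure ℝ) (n : ℕ) (w : ℝ → ℝ) : Matrix (Fin n) (Fin n) ℝ :=
  Matrix.of fun i j => ∫ x, x ^ (i : ℕ) * x ^ (j : ℕ) * w x ∂μ

lemma vandSq_eq_det_sq {n : ℕ} (l : Fin n → ℝ) :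
    vandSq l = (Matrix.vandermonde l).det ^ 2 := by
  rw [Matrix.det_vandermonde, vandSq, Finset.prod_pow]
  congr 1
  rw [Finset.prod_sigma', Finset.prod_filter, Finset.univ_product_univ.symm,
    Finset.prod_product_right, Finset.prod_sigma]
  refine Finset.prod_congr rfl fun i _ => ?_
  rw [← Finset.prod_filter]
  exact Finset.prod_congr (by ext; simp) fun _ _ => rfl

lemma measurable_vandSq {n : ℕ} : Measurable (vandSq : (Fin n → ℝ) → ℝ) := by
  unfold vandSq
  fun_prop

lemma vandSq_nonneg {n : ℕ} (l : Fin n → ℝ) : 0 ≤ vandSq l :=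
  Finset.prod_nonneg fun _ _ => sq_nonneg _

lemma vandSq_mul_prod_eq_sum {n : ℕ} (w : ℝ → ℝ) (l : Fin n → ℝ) :
    vandSq l * ∏ k, w (l k) = ∑ σ : Equiv.Perm (Fin n), ∑ τ : Equiv.Perm (Fin n),
      ((Equiv.Perm.sign σ : ℤ) : ℝ) * ((Equiv.Perm.sign τ : ℤ) : ℝ) *
        ∏ k, l k ^ (σ k : ℕ) * l k ^ (τ k : ℕ) * w (l k) := by
  rw [vandSq_eq_det_sq, ← Matrix.det_transpose, Matrix.det_apply', sq, Finset.sum_mul_sum,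
    Finset.sum_mul]
  refine Finset.sum_congr rfl fun σ _ => ?_
  rw [Finset.sum_mul]
  refine Finset.sum_congr rfl fun τ _ => ?_
  simp only [Matrix.transpose_apply, Matrix.vandermonde_apply, Finset.prod_mul_distrib]
  ring

/-- Integrability and value of the integral in Andréief's identity. -/
lemma integrable_and_integral_vandSq_mul_prod {μ : Measure ℝ} [IsProbabilityMeasure μ] (n : ℕ)
    {w : ℝ → ℝ} (hw : ∀ k : ℕ, Integrable (fun x => x ^ k * w x) μ) :
    Integrable (fun l : Fin n → ℝ => vandSq l * ∏ k, w (l k)) (Measure.pi fun _ => μ) ∧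
    ∫ l : Fin n → ℝ, vandSq l * ∏ k, w (l k) ∂(Measure.pi fun _ => μ) =
      n.factorial * (momentMatrix μ n w).det := by
  have hi : ∀ i j : ℕ, Integrable (fun x => x ^ i * x ^ j * w x) μ := fun i j => by
    simpa only [← pow_add] using hw (i + j)
  have hI : ∀ σ τ : Equiv.Perm (Fin n), Integrable (fun l : Fin n → ℝ =>
      ((Equiv.Perm.sign σ : ℤ) : ℝ) * ((Equiv.Perm.sign τ : ℤ) : ℝ) *
        ∏ k, l k ^ (σ k : ℕ) * l k ^ (τ k : ℕ) * w (l k)) (Measure.pi fun _ => μ) :=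
    fun σ τ => (Integrable.fintype_prod
      (f := fun k x => x ^ (σ k : ℕ) * x ^ (τ k : ℕ) * w x) fun k => hi _ _).const_mul _
  simp only [vandSq_mul_prod_eq_sum]
  refine ⟨integrable_finsetSum _ fun σ _ => integrable_finsetSum _ fun τ _ => hI σ τ, ?_⟩
  rw [integral_finsetSum _ fun σ _ => integrable_finsetSum _ fun τ _ => hI σ τ]
  have key : ∀ τ : Equiv.Perm (Fin n), ∑ σ : Equiv.Perm (Fin n),
      ((Equiv.Perm.sign σ : ℤ) : ℝ) * ((Equiv.Perm.sign τ : ℤ) : ℝ) *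
        ∏ k, momentMatrix μ n w (σ k) (τ k) = (momentMatrix μ n w).det := by
    intro τ
    have h := Matrix.det_permute' τ (momentMatrix μ n w)
    rw [Matrix.det_apply'] at h
    calc _ = ((Equiv.Perm.sign τ : ℤ) : ℝ) * ∑ σ : Equiv.Perm (Fin n),
          ((Equiv.Perm.sign σ : ℤ) : ℝ) *
            ∏ k, (momentMatrix μ n w).submatrix id τ (σ k) k := by
          rw [Finset.mul_sum]
          exact Finset.sum_congr rfl fun σ _ => by
            simp only [Matrix.submatrix_apply, id_eq]; ring
      _ = _ := by
          rw [h, ← mul_assoc, ← Int.cast_mul, ← Units.val_mul, Int.units_mul_self]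
          simp
  calc _ = ∑ σ : Equiv.Perm (Fin n), ∑ τ : Equiv.Perm (Fin n),
      ((Equiv.Perm.sign σ : ℤ) : ℝ) * ((Equiv.Perm.sign τ : ℤ) : ℝ) *
        ∏ k, momentMatrix μ n w (σ k) (τ k) := by
        refine Finset.sum_congr rfl fun σ _ => ?_
        rw [integral_finsetSum _ fun τ _ => hI σ τ]
        refine Finset.sum_congr rfl fun τ _ => ?_
        rw [integral_const_mul, integral_fintype_prod_eq_prod
          (f := fun k x => x ^ (σ k : ℕ) * x ^ (τ k : ℕ) * w x)]
        rfl
    _ = _ := by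
        rw [Finset.sum_comm, Finset.sum_congr rfl fun τ _ => key τ]
        simp [Fintype.card_perm]

lemma dotProduct_momentMatrix_mulVec {μ : Measure ℝ} {n : ℕ} {w : ℝ → ℝ}
    (hw : ∀ k : ℕ, Integrable (fun x => x ^ k * w x) μ) (v : Fin n → ℝ) :
    star v ⬝ᵥ ((momentMatrix μ n w).mulVec v) =
      ∫ x, (∑ i, v i * x ^ (i : ℕ)) ^ 2 * w x ∂μ := by
  have hi : ∀ i j : Fin n, Integrable
      (fun x => v i * v j * (x ^ (i : ℕ) * x ^ (j : ℕ) * w x)) μ := fun i j => by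
    simpa only [← pow_add] using (hw (i + j)).const_mul (v i * v j)
  calc _ = ∑ i, ∑ j, ∫ x, v i * v j * (x ^ (i : ℕ) * x ^ (j : ℕ) * w x) ∂μ := by
        simp only [dotProduct, Matrix.mulVec, star_trivial, Finset.mul_sum, integral_const_mul,
          momentMatrix, Matrix.of_apply]
        exact Finset.sum_congr rfl fun i _ => Finset.sum_congr rfl fun j _ => by ring
    _ = ∫ x, ∑ i, ∑ j, v i * v j * (x ^ (i : ℕ) * x ^ (j : ℕ) * w x) ∂μ := by
        rw [integral_finsetSum _ fun i _ => integrable_finsetSum _ fun j _ => hi i j]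
        exact Finset.sum_congr rfl fun i _ => (integral_finsetSum _ fun j _ => hi i j).symm
    _ = _ := by
        congr 1 with x
        rw [sq, Finset.sum_mul_sum, Finset.sum_mul]
        refine Finset.sum_congr rfl fun i _ => ?_
        rw [Finset.sum_mul]
        exact Finset.sum_congr rfl fun j _ => by ring

lemma isHermitian_momentMatrix (μ : Measure ℝ) (n : ℕ) (w : ℝ → ℝ) :
    (momentMatrix μ n w).IsHermitian := by
  ext i j
  simp only [momentMatrix, Matrix.conjTranspose_apply, Matrix.of_apply, star_trivial]
  congr 1 with x
  ring

lemma posSemidef_momentMatrix {μ : Measure ℝ} (n : ℕ) {w : ℝ → ℝ}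
    (hw : ∀ k : ℕ, Integrable (fun x => x ^ k * w x) μ) (hw0 : ∀ x, 0 ≤ w x) :
    (momentMatrix μ n w).PosSemidef := by
  refine .of_dotProduct_mulVec_nonneg (isHermitian_momentMatrix μ n w) fun v => ?_
  rw [dotProduct_momentMatrix_mulVec hw]
  exact integral_nonneg fun x => mul_nonneg (sq_nonneg _) (hw0 x)

lemma integrable_sum_mul_pow_sq {μ : Measure ℝ} (hm : HasAllMoments μ) {n : ℕ}
    (v : Fin n → ℝ) : Integrable (fun x => (∑ i, v i * x ^ (i : ℕ)) ^ 2) μ := by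
  have : (fun x : ℝ => (∑ i, v i * x ^ (i : ℕ)) ^ 2) =
      fun x => ∑ i, ∑ j, v i * v j * x ^ ((i : ℕ) + j) := by
    ext x
    rw [sq, Finset.sum_mul_sum]
    exact Finset.sum_congr rfl fun i _ => Finset.sum_congr rfl fun j _ => by ring
  rw [this]
  exact integrable_finsetSum _ fun i _ => integrable_finsetSum _ fun j _ => (hm _).const_mul _

lemma posDef_momentMatrix_one {μ : Measure ℝ} (hs : InfiniteSupport μ) (hm : HasAllMoments μ)
    (n : ℕ) : (momentMatrix μ n fun _ => 1).PosDef := by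
  refine .of_dotProduct_mulVec_pos (isHermitian_momentMatrix μ n _) fun v hv => ?_
  rw [dotProduct_momentMatrix_mulVec (fun k => by simpa using hm k)]
  simp only [mul_one]
  refine (integral_nonneg fun x => sq_nonneg _).lt_of_ne' fun h0 => ?_
  rw [integral_eq_zero_iff_of_nonneg (fun x => sq_nonneg _) (integrable_sum_mul_pow_sq hm v)] at h0
  set p : Polynomial ℝ := ∑ i : Fin n, Polynomial.monomial (i : ℕ) (v i) with hp
  have hpe : ∀ x, p.eval x = ∑ i, v i * x ^ (i : ℕ) := fun x => by
    simp [hp, Polynomial.eval_finsetSum]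
  have hp0 : p ≠ 0 := by
    obtain ⟨i, hi⟩ := Function.ne_iff.mp hv
    intro h
    apply hi
    have := congrArg (fun q => q.coeff (i : ℕ)) h
    simpa [hp, Polynomial.finsetSum_coeff, Polynomial.coeff_monomial, Fin.val_inj] using this
  refine hs p.roots.toFinset (measure_mono_null (fun x hx => ?_) (ae_iff.mp h0))
  simp only [Set.mem_compl_iff, Finset.mem_coe, Multiset.mem_toFinset, Polynomial.mem_roots hp0,
    Polynomial.IsRoot, hpe] at hx
  simpa using hx

lemma integral_vandSq_pos {μ : Measure ℝ} [IsProbabilityMeasure μ] (hs : InfiniteSupport μ)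
    (hm : HasAllMoments μ) (n : ℕ) :
    0 < ∫ l : Fin n → ℝ, vandSq l ∂(Measure.pi fun _ => μ) := by
  have h := (integrable_and_integral_vandSq_mul_prod (μ := μ) n (w := fun _ => 1)
    fun k => by simpa using hm k).2
  simp only [Finset.prod_const_one, mul_one] at h
  rw [h]
  exact mul_pos (by exact_mod_cast n.factorial_pos) (posDef_momentMatrix_one hs hm n).det_pos

lemma withDensity_vandSq_univ {μ : Measure ℝ} [IsProbabilityMeasure μ]
    (hm : HasAllMoments μ) (n : ℕ) :
    ((Measure.pi fun _ : Fin n => μ).withDensity fun l => ENNReal.ofReal (vandSq l)) Set.univ =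
      ENNReal.ofReal (∫ l : Fin n → ℝ, vandSq l ∂(Measure.pi fun _ => μ)) := by
  have h := (integrable_and_integral_vandSq_mul_prod (μ := μ) n (w := fun _ => 1)
    fun k => by simpa using hm k).1
  simp only [Finset.prod_const_one, mul_one] at h
  rw [withDensity_apply _ MeasurableSet.univ, Measure.restrict_univ,
    ofReal_integral_eq_lintegral_ofReal h (ae_of_all _ vandSq_nonneg)]

lemma isProbabilityMeasure_OPE {μ : Measure ℝ} [IsProbabilityMeasure μ] (hs : InfiniteSupport μ)
    (hm : HasAllMoments μ) (n : ℕ) : IsProbabilityMeasure (OPE μ n) := by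
  constructor
  rw [OPE, Measure.smul_apply, smul_eq_mul, withDensity_vandSq_univ hm]
  exact ENNReal.inv_mul_cancel (by simpa using integral_vandSq_pos hs hm n) ENNReal.ofReal_ne_top

lemma integral_OPE {μ : Measure ℝ} [IsProbabilityMeasure μ] (hm : HasAllMoments μ) {n : ℕ}
    (h : (Fin n → ℝ) → ℝ) :
    ∫ l, h l ∂(OPE μ n) = (∫ l : Fin n → ℝ, vandSq l ∂(Measure.pi fun _ => μ))⁻¹ *
      ∫ l : Fin n → ℝ, vandSq l * h l ∂(Measure.pi fun _ => μ) := by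
  rw [OPE, integral_smul_measure, withDensity_vandSq_univ hm, ENNReal.toReal_inv,
    ENNReal.toReal_ofReal (integral_nonneg vandSq_nonneg),
    integral_withDensity_eq_integral_toReal_smul measurable_vandSq.ennreal_ofReal
      (ae_of_all _ fun _ => ENNReal.ofReal_lt_top)]
  simp only [ENNReal.toReal_ofReal (vandSq_nonneg _), smul_eq_mul]

/-- Andréief's identity for the expectation of a product statistic. -/
lemma integral_prod_OPE {μ : Measure ℝ} [IsProbabilityMeasure μ] (hm : HasAllMoments μ) (n : ℕ)
    {w : ℝ → ℝ} (hw : ∀ k : ℕ, Integrable (fun x => x ^ k * w x) μ) :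
    ∫ l, ∏ k, w (l k) ∂(OPE μ n) =
      (momentMatrix μ n w).det / (momentMatrix μ n fun _ => 1).det := by
  have h := (integrable_and_integral_vandSq_mul_prod (μ := μ) n (w := fun _ => 1)
    fun k => by simpa using hm k).2
  simp only [Finset.prod_const_one, mul_one] at h
  have hn : (n.factorial : ℝ) ≠ 0 := by exact_mod_cast n.factorial_ne_zero
  rw [integral_OPE hm, (integrable_and_integral_vandSq_mul_prod n hw).2, h, inv_mul_eq_div,
    mul_div_mul_left _ _ hn]

lemma trace_mul_momentMatrix {μ : Measure ℝ} {n : ℕ} {w : ℝ → ℝ}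
    (hw : ∀ k : ℕ, Integrable (fun x => x ^ k * w x) μ) (M : Matrix (Fin n) (Fin n) ℝ) :
    (M * momentMatrix μ n w).trace =
      ∫ x, (∑ i, ∑ j, M i j * (x ^ (j : ℕ) * x ^ (i : ℕ))) * w x ∂μ := by
  have hi : ∀ i j : Fin n, Integrable
      (fun x => M i j * (x ^ (j : ℕ) * x ^ (i : ℕ) * w x)) μ := fun i j => by
    simpa only [← pow_add] using (hw (j + i)).const_mul (M i j)
  simp only [Finset.sum_mul, mul_assoc] at hi ⊢
  rw [integral_finsetSum _ fun i _ => integrable_finsetSum _ fun j _ => hi i j]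
  refine Finset.sum_congr rfl fun i _ => ?_
  rw [integral_finsetSum _ fun j _ => hi i j, Matrix.diag_apply, Matrix.mul_apply]
  refine Finset.sum_congr rfl fun j _ => ?_
  rw [integral_const_mul]
  simp only [momentMatrix, Matrix.of_apply, mul_assoc]

lemma HasAllMoments.integrable_pow_mul {μ : Measure ℝ} (hm : HasAllMoments μ) {w : ℝ → ℝ}
    (hw : Measurable w) {C : ℝ} (hC : ∀ x, |w x| ≤ C) (k : ℕ) :
    Integrable (fun x => x ^ k * w x) μ :=
  (hm k).mul_bdd hw.aestronglyMeasurable (ae_of_all _ hC)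

/-- Product statistics of the ensemble are dominated by those of `n` independent points with law
the normalised one-point intensity of the ensemble. -/
lemma exists_isProbabilityMeasure_integral_prod_OPE_le {μ : Measure ℝ} [IsProbabilityMeasure μ]
    (hs : InfiniteSupport μ) (hm : HasAllMoments μ) {n : ℕ} (hn : n ≠ 0) :
    ∃ ν : Measure ℝ, IsProbabilityMeasure ν ∧ ∀ w : ℝ → ℝ, Measurable w → (∀ x, 0 ≤ w x) →
      (∃ C, ∀ x, |w x| ≤ C) → ∫ l, ∏ k, w (l k) ∂(OPE μ n) ≤ (∫ x, w x ∂ν) ^ n := by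
  set G := momentMatrix μ n fun _ => 1 with hGdef
  have hG : G.PosDef := posDef_momentMatrix_one hs hm n
  set K : ℝ → ℝ := fun x => ∑ i, ∑ j, G⁻¹ i j * (x ^ (j : ℕ) * x ^ (i : ℕ)) with hK
  have hn' : (n : ℝ) ≠ 0 := by exact_mod_cast hn
  have hK0 : ∀ x, 0 ≤ K x / n := fun x => by
    refine div_nonneg ?_ n.cast_nonneg
    have h := hG.inv.posSemidef.dotProduct_mulVec_nonneg fun i => x ^ (i : ℕ)
    refine h.trans_eq ?_
    simp only [dotProduct, Matrix.mulVec, Pi.star_apply, star_trivial, Finset.mul_sum, hK]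
    exact Finset.sum_congr rfl fun i _ => Finset.sum_congr rfl fun j _ => by ring
  have hKm : Measurable fun x => K x / n := by
    simp only [hK]
    fun_prop
  have hKi : Integrable (fun x => K x / n) μ := by
    simp only [hK, ← pow_add]
    exact (integrable_finsetSum _ fun i _ => integrable_finsetSum _ fun j _ =>
      (hm _).const_mul _).div_const _
  have hK1 : ∫ x, K x / n ∂μ = 1 := by
    have h := trace_mul_momentMatrix (μ := μ) (w := fun _ => 1) (fun k => by simpa using hm k) G⁻¹
    rw [← hGdef, Matrix.nonsing_inv_mul _ hG.det_pos.ne'.isUnit, Matrix.trace_one] at h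
    simp only [mul_one, Fintype.card_fin] at h
    rw [integral_div, hK, ← h, div_self hn']
  refine ⟨μ.withDensity fun x => ENNReal.ofReal (K x / n), ⟨?_⟩, fun w hwm hw0 ⟨C, hC⟩ => ?_⟩
  · rw [withDensity_apply _ MeasurableSet.univ, Measure.restrict_univ,
      ← ofReal_integral_eq_lintegral_ofReal hKi (ae_of_all _ hK0), hK1, ENNReal.ofReal_one]
  · have hw := hm.integrable_pow_mul hwm hC
    rw [integral_prod_OPE hm n hw, integral_withDensity_eq_integral_toReal_smul
      hKm.ennreal_ofReal (ae_of_all _ fun _ => ENNReal.ofReal_lt_top), div_le_iff₀' hG.det_pos]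
    refine (hG.det_le_det_mul_trace_pow hn (posSemidef_momentMatrix n hw hw0)).trans_eq ?_
    congr 2
    rw [trace_mul_momentMatrix hw, ← integral_div]
    congr 1 with x
    rw [ENNReal.toReal_ofReal (hK0 x), smul_eq_mul, div_mul_eq_mul_div]

lemma ProbabilityTheory.HasSubgaussianMGF.integral_eq_zero {Ω : Type*}
    {mΩ : MeasurableSpace Ω} {P : Measure Ω} [IsProbabilityMeasure P] {X : Ω → ℝ} {c : NNReal}
    (h : HasSubgaussianMGF X c P) : ∫ ω, X ω ∂P = 0 := by
  set m := ∫ ω, X ω ∂P with hm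
  have key : ∀ t : ℝ, t * m ≤ c * t ^ 2 / 2 := fun t => by
    have hJ : Real.exp (∫ ω, t * X ω ∂P) ≤ ∫ ω, Real.exp (t * X ω) ∂P :=
      convexOn_exp.map_integral_le Real.continuous_exp.continuousOn isClosed_univ
        (ae_of_all _ fun _ => Set.mem_univ _) (h.integrable.const_mul t) (h.integrable_exp_mul t)
    rw [integral_const_mul] at hJ
    exact Real.exp_le_exp.mp (hJ.trans (h.mgf_le t))
  have hc : (0 : ℝ) < c + 1 := by positivity
  have h1 := key (m / (c + 1))
  obtain ⟨t, ht⟩ : ∃ t, t = m / ((c : ℝ) + 1) := ⟨_, rfl⟩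
  have hmt : m = t * (c + 1) := by rw [ht]; field_simp
  rw [← ht, hmt] at h1
  have ht0 : t = 0 := by
    have : t ^ 2 ≤ 0 := by nlinarith [mul_nonneg c.coe_nonneg (sq_nonneg t)]
    exact pow_eq_zero_iff two_ne_zero |>.mp (le_antisymm this (sq_nonneg t))
  rw [hmt, ht0, zero_mul]

lemma measurable_linStat {n : ℕ} {F : ℝ → ℝ} (hF : Measurable F) :
    Measurable (linStat F : (Fin n → ℝ) → ℝ) := by
  unfold linStat
  fun_prop

lemma abs_linStat_le {n : ℕ} {F : ℝ → ℝ} {c : ℝ} (hc : ∀ x, |F x| ≤ c) (l : Fin n → ℝ) :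
    |linStat F l| ≤ n * c :=
  (Finset.abs_sum_le_sum_abs _ _).trans
    ((Finset.sum_le_sum fun _ _ => hc _).trans_eq (by simp))

/-- Bounded linear statistics of orthogonal polynomial ensembles are sub-Gaussian. -/
lemma hasSubgaussianMGF_linStat {μ : Measure ℝ} [IsProbabilityMeasure μ]
    (hs : InfiniteSupport μ) (hm : HasAllMoments μ) {n : ℕ} (hn : n ≠ 0) {F : ℝ → ℝ}
    (hF : Measurable F) {c : NNReal} (hc : ∀ x, |F x| ≤ c) :
    HasSubgaussianMGF (fun l => linStat F l - ∫ l, linStat F l ∂(OPE μ n)) (n * c ^ 2)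
      (OPE μ n) := by
  have := isProbabilityMeasure_OPE hs hm n
  obtain ⟨ν, hν, hle⟩ := exists_isProbabilityMeasure_integral_prod_OPE_le hs hm hn
  have hH := hasSubgaussianMGF_of_mem_Icc (μ := ν) (X := F) hF.aemeasurable
    (ae_of_all _ fun x => abs_le.mp (hc x))
  have hcc : (‖(c : ℝ) - -(c : ℝ)‖₊ / 2) ^ 2 = c ^ 2 := by
    rw [sub_neg_eq_add, ← two_mul, nnnorm_mul]
    simp
  rw [hcc] at hH
  have hbd : ∀ l : Fin n → ℝ, linStat F l ∈ Set.Icc (-(n * c : ℝ)) (n * c) :=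
    fun l => abs_le.mp (abs_linStat_le hc l)
  have hX : HasSubgaussianMGF (fun l => linStat F l - n * ∫ x, F x ∂ν) (n * c ^ 2)
      (OPE μ n) := by
    refine ⟨fun t => integrable_exp_mul_of_mem_Icc (a := -(n * c : ℝ) - n * ∫ x, F x ∂ν)
      (b := n * c - n * ∫ x, F x ∂ν) ((measurable_linStat hF).sub_const _).aemeasurable
      (ae_of_all _ fun l => ⟨sub_le_sub_right (hbd l).1 _, sub_le_sub_right (hbd l).2 _⟩),
      fun t => ?_⟩
    have hw := hle (fun x => Real.exp (t * (F x - ∫ x, F x ∂ν))) (by fun_prop)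
      (fun x => (Real.exp_pos _).le) ⟨Real.exp (|t| * (c + |∫ x, F x ∂ν|)), fun x => by
        rw [Real.abs_exp, Real.exp_le_exp]
        refine (le_abs_self _).trans ?_
        rw [abs_mul]
        exact mul_le_mul_of_nonneg_left
          ((abs_sub _ _).trans (add_le_add_left (hc x) _)) (abs_nonneg t)⟩
    calc mgf (fun l => linStat F l - n * ∫ x, F x ∂ν) (OPE μ n) t
        = ∫ l, ∏ k, Real.exp (t * (F (l k) - ∫ x, F x ∂ν)) ∂(OPE μ n) := by
          refine integral_congr_ae (ae_of_all _ fun l => ?_)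
          simp only [← Real.exp_sum, ← Finset.mul_sum, Finset.sum_sub_distrib, linStat,
            Finset.sum_const, Finset.card_univ, Fintype.card_fin, nsmul_eq_mul]
      _ ≤ (∫ x, Real.exp (t * (F x - ∫ x, F x ∂ν)) ∂ν) ^ n := hw
      _ ≤ Real.exp ((c ^ 2 : NNReal) * t ^ 2 / 2) ^ n :=
          pow_le_pow_left₀ (integral_nonneg fun x => (Real.exp_pos _).le) (hH.mgf_le t) n
      _ = Real.exp ((n * c ^ 2 : NNReal) * t ^ 2 / 2) := by
          rw [← Real.exp_nat_mul]
          push_cast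
          ring_nf
  have hmean : ∫ l, linStat F l ∂(OPE μ n) = n * ∫ x, F x ∂ν := by
    have h := hX.integral_eq_zero
    rw [integral_sub (Integrable.of_mem_Icc _ _ (measurable_linStat hF).aemeasurable
      (ae_of_all _ hbd)) (integrable_const _)] at h
    simpa [sub_eq_zero] using h
  rwa [hmean]

lemma ProbabilityTheory.HasSubgaussianMGF.measureReal_abs_ge_le {Ω : Type*}
    {mΩ : MeasurableSpace Ω} {P : Measure Ω} [IsFiniteMeasure P] {X : Ω → ℝ} {c : NNReal}
    (h : HasSubgaussianMGF X c P) {r : ℝ} (hr : 0 ≤ r) :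
    P.real {ω | r ≤ |X ω|} ≤ 2 * Real.exp (-r ^ 2 / (2 * c)) := by
  have hset : {ω | r ≤ |X ω|} = {ω | r ≤ X ω} ∪ {ω | r ≤ (-X) ω} := by
    ext ω
    exact le_abs (a := r) (b := X ω)
  rw [hset, two_mul]
  exact (measureReal_union_le _ _).trans
    (add_le_add (h.measure_ge_le hr) (h.neg.measure_ge_le hr))

/-- **Mesoscopic concentration inequality for OPEs** (Theorem 1.2): there is a universal
constant `A > 0` such that for every probability measure `μ` on `ℝ` with infinite support
and all moments finite, every `x* ∈ ℝ`, `α > 0`, bounded measurable `f`, `ε > 0`, `N > 0`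
and `n ∈ ℕ`,
`P((1/N)|X_{f,α,x*} - E[X_{f,α,x*}]| ≥ ε) ≤ 2 exp(-ε min(εN²/(8An‖f‖_∞²), N/(6‖f‖_∞)))`. -/
theorem mesoscopic_concentration :
    ∃ A : ℝ, 0 < A ∧
      ∀ (μ : Measure ℝ), IsProbabilityMeasure μ → InfiniteSupport μ → HasAllMoments μ →
        ∀ xs : ℝ, ∀ α : ℝ, 0 < α →
          ∀ f : ℝ → ℝ, Measurable f → (∃ C : ℝ, ∀ x, |f x| ≤ C) →
            ∀ ε : ℝ, 0 < ε → ∀ N : ℝ, 0 < N → ∀ n : ℕ,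
              (OPE μ n) {l | ε ≤ (1 / N) *
                  |scaledLinStat f α xs l - ∫ l, scaledLinStat f α xs l ∂(OPE μ n)|} ≤
                ENNReal.ofReal (2 * Real.exp (-(ε *
                  min (ε * N ^ 2 / (8 * A * n * supNorm f ^ 2))
                    (N / (6 * supNorm f))))) := by
  refine ⟨1, one_pos, fun μ _ hs hm xs α _ f hf ⟨C, hC⟩ ε hε N hN n => ?_⟩
  have := isProbabilityMeasure_OPE hs hm n
  have hle1 : ∀ S : Set (Fin n → ℝ), ∀ r : ℝ, r ≤ 0 →
      OPE μ n S ≤ ENNReal.ofReal (2 * Real.exp (-(ε * r))) := fun S r hr => by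
    refine prob_le_one.trans (ENNReal.one_le_ofReal.mpr ?_)
    have := Real.one_le_exp (neg_nonneg.mpr (mul_nonpos_of_nonneg_of_nonpos hε.le hr))
    linarith
  rcases eq_or_ne n 0 with rfl | hn
  · exact hle1 _ _ ((min_le_left _ _).trans (by simp))
  have hfb : ∀ x, |f x| ≤ supNorm f := fun x =>
    le_ciSup (f := fun x => |f x|) ⟨C, by rintro _ ⟨x, rfl⟩; exact hC x⟩ x
  have hsn : 0 ≤ supNorm f := (abs_nonneg _).trans (hfb 0)
  obtain ⟨s, hsf⟩ : ∃ s : NNReal, (s : ℝ) = supNorm f := ⟨⟨supNorm f, hsn⟩, rfl⟩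
  have hsub := hasSubgaussianMGF_linStat hs hm hn (F := fun x => f ((n : ℝ) ^ α * (x - xs)))
    (by fun_prop) (c := s) fun x => hsf ▸ hfb _
  have htail := hsub.measureReal_abs_ge_le (mul_pos hN hε).le
  rw [← ofReal_measureReal]
  refine ENNReal.ofReal_le_ofReal ?_
  have hset : ∀ y : ℝ, ε ≤ 1 / N * |y| ↔ N * ε ≤ |y| := fun y => by
    rw [one_div, inv_mul_eq_div, le_div_iff₀' hN]
  simp only [hset]
  refine htail.trans ?_
  gcongr
  rw [neg_div, neg_le_neg_iff]
  refine (mul_le_mul_of_nonneg_left (min_le_left _ _) hε.le).trans ?_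
  have h0 : 0 ≤ (N * ε) ^ 2 / (n * supNorm f ^ 2) := by positivity
  calc _ = (N * ε) ^ 2 / (n * supNorm f ^ 2) / 8 := by
        rw [div_div, ← mul_div_assoc]
        ring_nf
    _ ≤ (N * ε) ^ 2 / (n * supNorm f ^ 2) / 2 := by linarith
    _ = _ := by
        rw [div_div]
        push_cast
        rw [hsf, mul_comm 2]
end
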